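/- arXiv:0910.1274 — 3 statements merged into one kernel-verified Lean document; each statement's English description precedes it below -/
import Mathlib

section
/- Let G be a finite group and let X be a compact topological space with a continuous right G-action which is a G-ENR, and let f: X → X be a continuous G-equivariant map. Then there exist an open G-invariant subset U of X containing the fixed point set {x | f(x) = x} and a continuous map ι: U → C([0,1], X) (paths in X, with the compact-open topology) such that: ι(x)(0) = x and ι(x)(1) = f(x) for all x ∈ U; ι is G-equivariant, i.e. ι(x·g)(t) = ι(x)(t)·g for all x ∈ U, g ∈ G, t ∈ [0,1]; and if f(x) = x then ι(x)(t) = x for all t ∈ [0,1]. In particular ι takes values in Λ^f_G X = {γ ∈ X^{[0,1]} | f(γ(0)) = γ(1)}. -/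
/-- `X` is a `G`-ENR: there are a finite-dimensional real linear representation of `G`
(acting on the right), an open invariant subset `W` of it, and continuous equivariant maps
`i : X → W` and `r : W → X` with `r ∘ i = id`. -/
def IsGENR {G X : Type*} [Group G] [TopologicalSpace X] (act : X → G → X) : Prop :=
  ∃ (n : ℕ) (ρ : G → (Fin n → ℝ) →ₗ[ℝ] (Fin n → ℝ)) (W : Set (Fin n → ℝ))
    (i : X → Fin n → ℝ) (r : (Fin n → ℝ) → X),
      (∀ v, ρ 1 v = v) ∧
      (∀ g g' v, ρ g' (ρ g v) = ρ (g * g') v) ∧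
      IsOpen W ∧
      (∀ v ∈ W, ∀ g, ρ g v ∈ W) ∧
      Continuous i ∧
      (∀ x, i x ∈ W) ∧
      (∀ x g, i (act x g) = ρ g (i x)) ∧
      ContinuousOn r W ∧
      (∀ v ∈ W, ∀ g, r (ρ g v) = act (r v) g) ∧
      (∀ x, r (i x) = x)

/-- For compact `K`, the set of `x` such that `H` maps `{x} × K` into a given open set is open. -/
lemma isOpen_setOf_forall_mem_of_compactSpace {X K Y : Type*} [TopologicalSpace X]
    [TopologicalSpace K] [CompactSpace K] [TopologicalSpace Y] {H : X × K → Y}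
    (hH : Continuous H) {W : Set Y} (hW : IsOpen W) : IsOpen {x | ∀ k, H (x, k) ∈ W} := by
  have h := (isClosedMap_fst_of_compactSpace (X := X) (Y := K)) _ (hW.preimage hH).isClosed_compl
  rw [← isOpen_compl_iff] at h
  convert h using 1
  ext x
  simp

/-- On a compact `G`-ENR, for any continuous equivariant `f : X → X` there are an open
invariant neighborhood `U` of the fixed point set of `f` and a continuous equivariant map
`ι : U → C([0,1], X)` with `ι(x)(0) = x`, `ι(x)(1) = f(x)`, and `ι(x)` constant whenever
`f(x) = x`; in particular `ι` takes values in `Λ^f_G X = {γ | f(γ(0)) = γ(1)}`. -/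
theorem exists_equivariant_path_contraction
    {G X : Type*} [Group G] [Finite G] [TopologicalSpace X] [CompactSpace X]
    (act : X → G → X)
    (hone : ∀ x, act x 1 = x)
    (hmul : ∀ x g g', act (act x g) g' = act x (g * g'))
    (hactc : ∀ g, Continuous fun x => act x g)
    (hENR : IsGENR act)
    (f : X → X) (hf : Continuous f)
    (hfequiv : ∀ x g, f (act x g) = act (f x) g) :
    ∃ U : Set X,
      IsOpen U ∧
      {x | f x = x} ⊆ U ∧
      (∀ x ∈ U, ∀ g : G, act x g ∈ U) ∧
      ∃ ι : X → C(unitInterval, X),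
        ContinuousOn ι U ∧
        (∀ x ∈ U, ι x 0 = x) ∧
        (∀ x ∈ U, ι x 1 = f x) ∧
        (∀ x ∈ U, ∀ g : G, ∀ t : unitInterval, ι (act x g) t = act (ι x t) g) ∧
        (∀ x ∈ U, f x = x → ∀ t : unitInterval, ι x t = x) ∧
        (∀ x ∈ U, f (ι x 0) = ι x 1) := by
  classical
  obtain ⟨n, ρ, W, i, r, -, -, hW, hWρ, hi, hiW, hiact, hr, hract, hri⟩ := hENR
  let H : X × unitInterval → Fin n → ℝ :=
    fun p => (1 - (p.2 : ℝ)) • i p.1 + (p.2 : ℝ) • i (f p.1)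
  have hH : Continuous H := by fun_prop
  have hHact : ∀ x g t, H (act x g, t) = ρ g (H (x, t)) := fun x g t => by
    simp only [H, hfequiv, hiact, map_add, map_smul]
  have hHfix : ∀ x t, f x = x → H (x, t) = i x := fun x t hx => by
    simp only [H, hx, ← add_smul, sub_add_cancel, one_smul]
  let U : Set X := {x | ∀ t, H (x, t) ∈ W}
  have hUact : ∀ x ∈ U, ∀ g, act x g ∈ U := fun x hx g t => by
    rw [hHact]
    exact hWρ _ (hx t) g
  let F : C(U × unitInterval, X) :=
    ⟨fun p => r (H (p.1, p.2)), hr.comp_continuous (by fun_prop) fun p => p.1.2 p.2⟩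
  let ι : X → C(unitInterval, X) :=
    fun x => if hx : x ∈ U then F.curry ⟨x, hx⟩ else ContinuousMap.const _ x
  have hι : ∀ x ∈ U, ∀ t, ι x t = r (H (x, t)) := fun x hx t => by
    simp only [ι, dif_pos hx]
    rfl
  have hι0 : ∀ x ∈ U, ι x 0 = x := fun x hx => by
    simp [hι x hx, H, hri]
  have hι1 : ∀ x ∈ U, ι x 1 = f x := fun x hx => by
    simp [hι x hx, H, hri]
  refine ⟨U, isOpen_setOf_forall_mem_of_compactSpace hH hW, fun x hx t => ?_, hUact, ι,
    ?_, hι0, hι1, fun x hx g t => ?_, fun x hx hfx t => ?_, fun x hx => ?_⟩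
  · rw [hHfix x t hx]
    exact hiW x
  · rw [continuousOn_iff_continuous_domRestrict]
    convert F.curry.continuous using 1
    ext1 x
    simp [ι]
  · rw [hι _ (hUact x hx g), hι x hx, hHact, hract _ (hx t)]
  · rw [hι x hx, hHfix x t hfx, hri]
  · rw [hι0 x hx, hι1 x hx]
end

section
/- Let A be a small EI-category (every endomorphism in A is an isomorphism), let B be a set of objects of A containing exactly one representative of each isomorphism class, and let F: A → A be a functor such that for all distinct a, b ∈ B at least one of the hom-sets A(F(a), b) and A(b, a) is empty. Define the shadow sh(A^F) as the quotient of the disjoint union ∐_{a ∈ Ob A} A(F(a), a) by the equivalence relation generated by: for every morphism m: a → a' and every z: F(a') → a, the element m∘z ∈ A(F(a'), a') is related to z∘F(m) ∈ A(F(a), a). For each b ∈ B define sh(A(F(b), b)) as the quotient of A(F(b), b) by the equivalence relation generated by m∘z ∼ z∘F(m) for m: b → b and z: F(b) → b. Then the canonical map ∐_{b ∈ B} sh(A(F(b), b)) → sh(A^F) is a bijection. -/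
open CategoryTheory

/-- The relation generating the shadow `sh(A^F)`: for `m : a ⟶ a'` and `z : F(a') ⟶ a`, the
element `m ∘ z ∈ A(F(a'), a')` is related to `z ∘ F(m) ∈ A(F(a), a)`. -/
def ShRel {A : Type*} [Category A] (F : A ⥤ A) :
    (Σ a : A, (F.obj a ⟶ a)) → (Σ a : A, (F.obj a ⟶ a)) → Prop :=
  fun p q => ∃ (a a' : A) (m : a ⟶ a') (z : F.obj a' ⟶ a),
    p = ⟨a', z ≫ m⟩ ∧ q = ⟨a, F.map m ≫ z⟩

/-- The relation generating the local shadow `sh(A(F(b), b))`: for `m : b ⟶ b` and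
`z : F(b) ⟶ b`, `m ∘ z` is related to `z ∘ F(m)`. -/
def ShRelLocal {A : Type*} [Category A] (F : A ⥤ A) (b : A) :
    (F.obj b ⟶ b) → (F.obj b ⟶ b) → Prop :=
  fun z₁ z₂ => ∃ (m : b ⟶ b) (z : F.obj b ⟶ b), z₁ = z ≫ m ∧ z₂ = F.map m ≫ z

/-- The canonical map `sh(A(F(b), b)) → sh(A^F)`. -/
def localToGlobal {A : Type*} [Category A] (F : A ⥤ A) (b : A) :
    Quot (ShRelLocal F b) → Quot (ShRel F) :=
  Quot.lift (fun z => Quot.mk (ShRel F) ⟨b, z⟩) (by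
    rintro z₁ z₂ ⟨m, z, h₁, h₂⟩
    subst h₁; subst h₂
    exact Quot.sound ⟨b, b, m, z, rfl, rfl⟩)

/-- Conjugating an element of the shadow by an isomorphism does not change its class. -/
theorem ShRel.mk_conj {A : Type*} [Category A] (F : A ⥤ A) {a b : A} (e : a ≅ b)
    (z : F.obj a ⟶ a) :
    Quot.mk (ShRel F) ⟨b, F.map e.inv ≫ z ≫ e.hom⟩ = Quot.mk (ShRel F) ⟨a, z⟩ :=
  Quot.sound ⟨a, b, e.hom, F.map e.inv ≫ z, by simp, by simp [← Functor.map_comp_assoc]⟩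

/-- If `A(F(a), b)` or `A(b, a)` is empty for all distinct `a, b ∈ B`, then the cyclicity relation
between objects of `B` holds in the disjoint union of the local shadows. -/
theorem ShRelLocal.sigma_mk_eq {A : Type*} [Category A] {F : A ⥤ A} {B : Set A}
    (hF : ∀ a ∈ B, ∀ b ∈ B, a ≠ b → IsEmpty (F.obj a ⟶ b) ∨ IsEmpty (b ⟶ a))
    (b b' : B) (m : b.1 ⟶ b'.1) (z : F.obj b'.1 ⟶ b.1) :
    (⟨b', Quot.mk _ (z ≫ m)⟩ : Σ b : B, Quot (ShRelLocal F b.1)) =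
      ⟨b, Quot.mk _ (F.map m ≫ z)⟩ := by
  obtain rfl : b' = b := by
    by_contra h
    rcases hF b' b'.2 b b.2 (fun h' => h (Subtype.ext h')) with h' | h'
    · exact h'.false z
    · exact h'.false m
  exact congrArg (Sigma.mk b') (Quot.sound ⟨m, z, rfl, rfl⟩)

/-- For an EI-category `A`, a set `B` of representatives of the isomorphism classes of
objects, and a functor `F : A → A` such that for distinct `a, b ∈ B` at least one of
`A(F(a), b)`, `A(b, a)` is empty, the canonical map `∐_{b ∈ B} sh(A(F(b), b)) → sh(A^F)`
is a bijection. -/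
theorem shadow_decomposition
    {A : Type*} [Category A]
    (hEI : ∀ (a : A) (f : a ⟶ a), IsIso f)
    (B : Set A)
    (hBex : ∀ a : A, ∃ b ∈ B, Nonempty (a ≅ b))
    (hBuniq : ∀ b ∈ B, ∀ b' ∈ B, Nonempty (b ≅ b') → b = b')
    (F : A ⥤ A)
    (hF : ∀ a ∈ B, ∀ b ∈ B, a ≠ b → IsEmpty (F.obj a ⟶ b) ∨ IsEmpty (b ⟶ a)) :
    Function.Bijective
      (fun p : Σ b : B, Quot (ShRelLocal F b.1) => localToGlobal F p.1.1 p.2) := by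
  choose r hrB hr using hBex
  let e (a : A) : a ≅ r a := (hr a).some
  let inverse : Quot (ShRel F) → Σ b : B, Quot (ShRelLocal F b.1) :=
    Quot.lift (fun p => ⟨⟨r p.1, hrB p.1⟩,
      Quot.mk _ (F.map (e p.1).inv ≫ p.2 ≫ (e p.1).hom)⟩) (by
      rintro _ _ ⟨a, a', m, z, rfl, rfl⟩
      simpa using ShRelLocal.sigma_mk_eq hF ⟨r a, hrB a⟩ ⟨r a', hrB a'⟩
        ((e a).inv ≫ m ≫ (e a').hom) (F.map (e a').inv ≫ z ≫ (e a).hom))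
  refine Function.bijective_iff_has_inverse.mpr ⟨inverse, ?_, ?_⟩
  · rintro ⟨b, ⟨z⟩⟩
    have h := ShRelLocal.sigma_mk_eq hF b ⟨r b, hrB b⟩ (e b).hom (F.map (e b).inv ≫ z)
    rw [Category.assoc, ← Functor.map_comp_assoc, Iso.hom_inv_id, CategoryTheory.Functor.map_id,
      Category.id_comp] at h
    exact h
  · rintro ⟨a, z⟩
    exact ShRel.mk_conj F (e a) z
end

section
/- Let W be a group acting continuously on the right on a topological space X (each element acting by a homeomorphism), and let f: X → X be a continuous W-equivariant map. Let y, z ∈ X and g, h ∈ W, let δ be a path in X from f(y) to z·g, and let γ be a path in X from z to y·h. Suppose that the concatenation of δ followed by γ·g (where γ·g is the path t ↦ γ(t)·g) is path-homotopic, with endpoints fixed, to the constant path at f(y), and that the concatenation of f∘γ followed by δ·h is path-homotopic, with endpoints fixed, to the constant path at f(z). Then f∘γ is path-homotopic, with endpoints fixed, to the path γ·(gh): t ↦ γ(t)·(gh). -/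
/-- A path whose underlying map is homotopic, relative to the endpoints, to a constant map is
a loop at that constant. -/
theorem Path.endpoint_eq_of_homotopicRel_const {X : Type*} [TopologicalSpace X] {a b x : X}
    {p : Path a b}
    (hp : p.toContinuousMap.HomotopicRel (ContinuousMap.const unitInterval x) {0, 1}) :
    b = x := by
  simpa using ContinuousMap.HomotopicRel.fst_eq_snd hp (x := (1 : unitInterval)) (by simp)

/-- In the fundamental groupoid, a left inverse and a right inverse of a path agree. -/
theorem Path.homotopicRel_of_trans_homotopicRel_const {X : Type*} [TopologicalSpace X]
    {a b c d : X} {p : Path a b} {q : Path b c} {r : Path c d}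
    (hpq : (p.trans q).toContinuousMap.HomotopicRel (ContinuousMap.const unitInterval a) {0, 1})
    (hqr : (q.trans r).toContinuousMap.HomotopicRel (ContinuousMap.const unitInterval b) {0, 1}) :
    p.toContinuousMap.HomotopicRel r.toContinuousMap {0, 1} := by
  obtain rfl := Path.endpoint_eq_of_homotopicRel_const hpq
  obtain rfl := Path.endpoint_eq_of_homotopicRel_const hqr
  have hpq' : (p.trans q).Homotopic (Path.refl _) := hpq
  have hqr' : (q.trans r).Homotopic (Path.refl _) := hqr
  have h₁ : p.Homotopic (p.trans (q.trans r)) :=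
    (Path.Homotopic.trans_refl p).symm.trans
      ((Path.Homotopic.refl p).hcomp hqr'.symm)
  have h₂ : ((p.trans q).trans r).Homotopic r :=
    (hpq'.hcomp (Path.Homotopic.refl r)).trans (Path.Homotopic.refl_trans r)
  exact h₁.trans ((Path.Homotopic.trans_assoc p q r).symm.trans h₂)

/-- Let `W` act continuously on the right on `X` and `f : X → X` be continuous and
equivariant.  Suppose `δ` is a path from `f(y)` to `z·g` and `γ` a path from `z` to `y·h`
such that `δ` followed by `γ·g` is path-homotopic (rel endpoints) to the constant path at
`f(y)`, and `f∘γ` followed by `δ·h` is path-homotopic (rel endpoints) to the constant path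
at `f(z)`.  Then `f∘γ` is path-homotopic (rel endpoints) to `γ·(gh)`. -/
theorem path_conjugacy_of_fixed_class
    {W X : Type*} [Group W] [TopologicalSpace X]
    (act : X → W → X)
    (hone : ∀ x, act x 1 = x)
    (hmul : ∀ x w w', act (act x w) w' = act x (w * w'))
    (hactc : ∀ w, Continuous fun x => act x w)
    (f : X → X) (hf : Continuous f)
    (hfequiv : ∀ x w, f (act x w) = act (f x) w)
    (y z : X) (g h : W)
    (δ : Path (f y) (act z g)) (γ : Path z (act y h))
    (h₁ : (δ.trans (γ.map (hactc g))).toContinuousMap.HomotopicRel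
      (ContinuousMap.const unitInterval (f y)) {0, 1})
    (h₂ : ((γ.map hf).trans ((δ.map (hactc h)).cast (hfequiv y h) rfl)).toContinuousMap.HomotopicRel
      (ContinuousMap.const unitInterval (f z)) {0, 1}) :
    (γ.map hf).toContinuousMap.HomotopicRel
      (γ.map (hactc (g * h))).toContinuousMap {0, 1} := by
  have hqr := ContinuousMap.HomotopicRel.comp_continuousMap h₁ ⟨_, hactc h⟩
  let r : Path (act (act z g) h) (act (act (act y h) g) h) :=
    (γ.map (hactc g)).map (hactc h)
  have hr : r.toContinuousMap = (γ.map (hactc (g * h))).toContinuousMap := by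
    ext t
    exact hmul (γ t) g h
  rw [← hr]
  refine Path.homotopicRel_of_trans_homotopicRel_const h₂ ?_
  convert hqr using 1
  · ext t
    exact DFunLike.congr_fun (Path.map_trans δ (γ.map (hactc g)) (hactc h)).symm t
  · ext t
    exact hfequiv y h
end
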